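/- Let X and Y be realcompact (completely regular Hausdorff) spaces and let E and F be C*-algebras. Suppose T : C(X,E) → C(Y,F) is a *-algebra isomorphism (a bijective, linear, multiplicative, star-preserving map, where C(X,E) and C(Y,F) are *-algebras under pointwise operations) such that Z(f) ≠ ∅ ⟺ Z(Tf) ≠ ∅ for every f ∈ C(X,E). Then there are a homeomorphism h : Y → X and, for each y ∈ Y, a *-algebra isomorphism S_y : E → F such that Tf(y) = S_y(f(h(y))) for all f ∈ C(X,E) and all y ∈ Y. -/

import Mathlib

open Set Filter Topology

/-- A map `T` between `C(X,E)` and `C(Y,F)` preserves common zeros if for every `k ∈ ℕ` and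
every finite family `f₁, …, f_k` in `C(X,E)`, the zero sets of the `fᵢ` have a common point
iff the zero sets of the `T fᵢ` do. -/
def PreservesCommonZerosC {X Y E F : Type*} [TopologicalSpace X] [TopologicalSpace Y]
    [TopologicalSpace E] [Zero E] [TopologicalSpace F] [Zero F]
    (T : C(X, E) → C(Y, F)) : Prop :=
  ∀ (k : ℕ) (f : Fin (k + 1) → C(X, E)),
    (⋂ i, {x | f i x = 0}).Nonempty ↔ (⋂ i, {y | T (f i) y = 0}).Nonempty

/-- The unique continuous extension `ψ* : βY → ℝ ∪ {∞}` of `ψ ∈ C(Y)` with values in the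
one-point compactification of `ℝ`. -/
noncomputable def onePointExt {Y : Type*} [TopologicalSpace Y] (ψ : C(Y, ℝ)) :
    StoneCech Y → OnePoint ℝ :=
  stoneCechExtend (OnePoint.continuous_coe.comp ψ.continuous)

/-- The Hewitt realcompactification `υY ⊆ βY`: the set of points of `βY` at which the
extension of every real-valued continuous function on `Y` takes a finite value. -/
def hewittRealcompactification (Y : Type*) [TopologicalSpace Y] : Set (StoneCech Y) :=
  {p | ∀ ψ : C(Y, ℝ), onePointExt ψ p ≠ OnePoint.infty}

/-- A completely regular Hausdorff space is realcompact if the image of the canonical map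
`ι_X : X → βX` is exactly the Hewitt realcompactification `υX`. -/
def Realcompact (X : Type*) [TopologicalSpace X] : Prop :=
  Set.range (stoneCechUnit : X → StoneCech X) = hewittRealcompactification X

/-- The embedding of the real-valued continuous functions on `X` in `C(X, E)` as the multiples
of the unit. -/
noncomputable def scalarFunctions (X E : Type*) [TopologicalSpace X] [CStarAlgebra E] :
    C(X, ℝ) →⋆ₐ[ℝ] C(X, E) where
  toFun φ := ⟨fun x => algebraMap ℝ E (φ x), by fun_prop⟩
  map_one' := by ext; simp
  map_mul' _ _ := by ext; simp
  map_zero' := by ext; simp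
  map_add' _ _ := by ext; simp
  commutes' _ := by ext; simp [Algebra.algebraMap_eq_smul_one]
  map_star' φ := by ext x; exact algebraMap_star_comm (φ x)

lemma scalarFunctions_apply {X E : Type*} [TopologicalSpace X] [CStarAlgebra E] (φ : C(X, ℝ))
    (x : X) : scalarFunctions X E φ x = algebraMap ℝ E (φ x) := rfl

lemma scalarFunctions_apply_eq_zero {X E : Type*} [TopologicalSpace X] [CStarAlgebra E]
    [Nontrivial E] {φ : C(X, ℝ)} {x : X} : scalarFunctions X E φ x = 0 ↔ φ x = 0 := by
  rw [scalarFunctions_apply, map_eq_zero_iff _ (algebraMap ℝ E).injective]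

/-- Evaluation at `y` of a star homomorphism `C(X, E) → C(Y, F)` on real scalar functions. -/
noncomputable def scalarEval {X Y E F : Type*} [TopologicalSpace X] [TopologicalSpace Y]
    [CStarAlgebra E] [CStarAlgebra F] (T : C(X, E) ≃⋆ₐ[ℂ] C(Y, F)) (y : Y) : C(X, ℝ) →⋆ₐ[ℝ] F where
  toFun φ := T (scalarFunctions X E φ) y
  map_one' := by simp
  map_mul' _ _ := by simp
  map_zero' := by simp
  map_add' _ _ := by simp
  commutes' r := by
    have h : scalarFunctions X E (algebraMap ℝ C(X, ℝ) r) = (r : ℂ) • (1 : C(X, E)) := by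
      ext x
      simp [Algebra.algebraMap_eq_smul_one]
    rw [h, map_smul, map_one]
    simp [Algebra.algebraMap_eq_smul_one]
  map_star' φ := by rw [map_star, map_star, ContinuousMap.star_apply]

/-- A star homomorphism from `C(X, ℝ)` to a C⋆-algebra kills the part of `ψ` exceeding
the norm of its image. -/
lemma map_sub_norm_sup_zero {X B : Type*} [TopologicalSpace X] [CStarAlgebra B]
    (Φ : C(X, ℝ) →⋆ₐ[ℝ] B) (ψ : C(X, ℝ)) :
    Φ ((ψ - algebraMap ℝ C(X, ℝ) ‖Φ ψ‖) ⊔ 0) = 0 := by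
  let _ := CStarAlgebra.spectralOrder B
  have _ := CStarAlgebra.spectralOrderedRing B
  set d : C(X, ℝ) := ψ - algebraMap ℝ C(X, ℝ) ‖Φ ψ‖ with hd
  set u : C(X, ℝ) := d ⊔ 0 with hu
  let w : C(X, ℝ) := ⟨fun x => √(u x), by fun_prop⟩
  have hw : star w * d * w = star u * u := by
    ext x
    have h0 : 0 ≤ u x := le_max_right (d x) 0
    have h1 : √(u x) * √(u x) = u x := Real.mul_self_sqrt h0
    have h2 : u x * d x = u x * u x := by
      change max (d x) 0 * d x = max (d x) 0 * max (d x) 0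
      rcases le_total (d x) 0 with h | h <;> simp [h]
    change √(u x) * d x * √(u x) = u x * u x
    linear_combination d x * h1 + h2
  have hψ : IsSelfAdjoint (Φ ψ) := by
    have : IsSelfAdjoint ψ := by ext x; rfl
    exact this.map Φ
  have hΦd : Φ d ≤ 0 := by
    rw [hd, map_sub, AlgHomClass.commutes, sub_nonpos]
    exact hψ.le_algebraMap_norm_self
  have h := star_left_conjugate_le_conjugate hΦd (Φ w)
  rw [mul_zero, zero_mul, ← map_star, ← map_mul, ← map_mul, hw, map_mul, map_star] at h
  exact (CStarRing.star_mul_self_eq_zero_iff _).1 (h.antisymm (star_mul_self_nonneg _))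

lemma sum_star_mul_self_apply_eq_zero {X E : Type*} [TopologicalSpace X] [CStarAlgebra E]
    (s : Finset C(X, E)) (x : X) :
    (∑ f ∈ s, star f * f) x = 0 ↔ ∀ f ∈ s, f x = 0 := by
  let _ := CStarAlgebra.spectralOrder E
  have _ := CStarAlgebra.spectralOrderedRing E
  rw [ContinuousMap.sum_apply, Finset.sum_eq_zero_iff_of_nonneg]
  · simp [CStarRing.star_mul_self_eq_zero_iff]
  · intro f _
    exact star_mul_self_nonneg (f x)

lemma exists_forall_apply_eq_zero_of_realcompact {X Y E F : Type*}
    [TopologicalSpace X] [CompletelyRegularSpace X] [TopologicalSpace Y]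
    (hX : Realcompact X) [CStarAlgebra E] [Nontrivial E] [CStarAlgebra F]
    (T : C(X, E) ≃⋆ₐ[ℂ] C(Y, F))
    (hT : ∀ f : C(X, E), {y | T f y = 0}.Nonempty → {x | f x = 0}.Nonempty) (y : Y) :
    ∃ x, ∀ f, T f y = 0 → f x = 0 := by
  classical
  obtain ⟨p, -, hp⟩ := isCompact_univ.inter_iInter_nonempty
    (fun f : {f : C(X, E) // T f y = 0} => closure (stoneCechUnit '' {x | f.1 x = 0}))
    (fun _ => isClosed_closure) (by
      intro s
      obtain ⟨x, hx⟩ := hT (∑ f ∈ s.image Subtype.val, star f * f) ⟨y, by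
        simp only [mem_ofPred_eq, map_sum, ContinuousMap.sum_apply]
        refine Finset.sum_eq_zero fun f hf => ?_
        obtain ⟨g, -, rfl⟩ := Finset.mem_image.1 hf
        simp [g.2]⟩
      rw [mem_ofPred_eq, sum_star_mul_self_apply_eq_zero] at hx
      refine ⟨stoneCechUnit x, mem_univ _, mem_iInter₂.2 fun f hf => subset_closure ?_⟩
      exact mem_image_of_mem _ (hx _ (Finset.mem_image_of_mem _ hf)))
  rw [mem_iInter] at hp
  have hpX : p ∈ hewittRealcompactification X := by
    intro ψ hψ
    let f := scalarFunctions X E ((|ψ| - algebraMap ℝ C(X, ℝ) ‖scalarEval T y |ψ|‖) ⊔ 0)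
    have hf : T f y = 0 := map_sub_norm_sup_zero (scalarEval T y) |ψ|
    set M := ‖scalarEval T y |ψ|‖
    have hK : IsClosed ((↑) '' Icc (-M) M : Set (OnePoint ℝ)) :=
      (isCompact_Icc.image OnePoint.continuous_coe).isClosed
    have hsub : stoneCechUnit '' {x | f x = 0} ⊆ onePointExt ψ ⁻¹' ((↑) '' Icc (-M) M) := by
      rintro _ ⟨x, hx, rfl⟩
      have hx' := scalarFunctions_apply_eq_zero.1 hx
      have hx'' : max (|ψ x| - M) 0 = 0 := by
        simpa [Algebra.algebraMap_eq_smul_one] using hx'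
      refine ⟨ψ x, abs_le.1 ?_,
        (congr_fun (stoneCechExtend_extends (OnePoint.continuous_coe.comp ψ.continuous)) x).symm⟩
      linarith [le_max_left (|ψ x| - M) 0]
    have hmem := closure_minimal hsub (hK.preimage (continuous_stoneCechExtend _)) (hp ⟨f, hf⟩)
    rw [mem_preimage, hψ] at hmem
    obtain ⟨r, -, hr⟩ := hmem
    exact OnePoint.coe_ne_infty r hr
  obtain ⟨x, rfl⟩ : p ∈ Set.range (stoneCechUnit : X → StoneCech X) := hX ▸ hpX
  refine ⟨x, fun f hf => ?_⟩
  have h := hp ⟨f, hf⟩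
  rw [← mem_preimage, ← isInducing_stoneCechUnit.closure_eq_preimage_closure_image] at h
  exact (isClosed_singleton.preimage f.continuous).closure_subset h

lemma exists_scalarFunctions_separating {X : Type*} (E : Type*) [TopologicalSpace X]
    [CompletelyRegularSpace X] [CStarAlgebra E] [Nontrivial E] {K : Set X} (hK : IsClosed K)
    {x : X} (hx : x ∉ K) : ∃ f : C(X, E), f x ≠ 0 ∧ ∀ z ∈ K, f z = 0 := by
  obtain ⟨g, hg, hgx, hgK⟩ := CompletelyRegularSpace.completely_regular x K hK hx
  let φ : C(X, ℝ) := ⟨fun z => 1 - g z, by fun_prop⟩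
  refine ⟨scalarFunctions X E φ, ?_, fun z hz => ?_⟩
  · rw [Ne, scalarFunctions_apply_eq_zero]
    simp [φ, hgx]
  · rw [scalarFunctions_apply_eq_zero]
    simp [φ, hgK hz]

lemma eq_of_forall_apply_eq_zero {X : Type*} (E : Type*) [TopologicalSpace X] [T2Space X]
    [CompletelyRegularSpace X] [CStarAlgebra E] [Nontrivial E] {x z : X}
    (h : ∀ f : C(X, E), f x = 0 → f z = 0) : x = z := by
  by_contra hne
  obtain ⟨f, hf, hfx⟩ := exists_scalarFunctions_separating E (isClosed_singleton (x := x))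
    (x := z) (fun hz => hne hz.symm)
  exact hf (h f (hfx x rfl))

lemma continuous_of_apply_eq_zero_iff {X Y E F : Type*} [TopologicalSpace X]
    [CompletelyRegularSpace X] [TopologicalSpace Y] [CStarAlgebra E] [Nontrivial E]
    [CStarAlgebra F] (T : C(X, E) → C(Y, F)) (h : Y → X)
    (hT : ∀ f y, T f y = 0 ↔ f (h y) = 0) : Continuous h := by
  refine continuous_iff_isClosed.2 fun K hK => ?_
  have hpre : h ⁻¹' K = ⋂ f : {f : C(X, E) // ∀ z ∈ K, f z = 0}, {y | T f.1 y = 0} := by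
    ext y
    simp only [mem_preimage, mem_iInter, mem_ofPred_eq, hT]
    refine ⟨fun hy f => f.2 _ hy, fun hy => ?_⟩
    by_contra hyK
    obtain ⟨f, hf, hfK⟩ := exists_scalarFunctions_separating E hK hyK
    exact hf (hy ⟨f, hfK⟩)
  rw [hpre]
  exact isClosed_iInter fun f => isClosed_singleton.preimage (T f.1).continuous

lemma exists_homeomorph_apply_eq_zero_iff {X Y E F : Type*}
    [TopologicalSpace X] [T2Space X] [CompletelyRegularSpace X]
    [TopologicalSpace Y] [T2Space Y] [CompletelyRegularSpace Y]
    (hX : Realcompact X) (hY : Realcompact Y)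
    [CStarAlgebra E] [Nontrivial E] [CStarAlgebra F] [Nontrivial F]
    (T : C(X, E) ≃⋆ₐ[ℂ] C(Y, F))
    (hTz : ∀ f : C(X, E), {x | f x = 0}.Nonempty ↔ {y | T f y = 0}.Nonempty) :
    ∃ h : Y ≃ₜ X, ∀ f y, T f y = 0 ↔ f (h y) = 0 := by
  choose h hh using exists_forall_apply_eq_zero_of_realcompact hX T fun f => (hTz f).2
  choose k hk using exists_forall_apply_eq_zero_of_realcompact hY T.symm fun g hg => by
    simpa using (hTz (T.symm g)).1 hg
  have hk' (x : X) (f : C(X, E)) (hf : f x = 0) : T f (k x) = 0 :=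
    hk x (T f) (by simpa using hf)
  have hkh (y : Y) : k (h y) = y := by
    refine (eq_of_forall_apply_eq_zero F fun g hg => ?_).symm
    simpa using hk' (h y) (T.symm g) (hh y _ (by simpa using hg))
  have hhk (x : X) : h (k x) = x :=
    (eq_of_forall_apply_eq_zero E fun f hf => hh (k x) f (hk' x f hf)).symm
  have hiff (f : C(X, E)) (y : Y) : T f y = 0 ↔ f (h y) = 0 :=
    ⟨hh y f, fun hf => by simpa [hkh] using hk' (h y) f hf⟩
  have hiff' (g : C(Y, F)) (x : X) : T.symm g x = 0 ↔ g (k x) = 0 := by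
    simpa [hhk] using (hiff (T.symm g) (k x)).symm
  exact ⟨{ toFun := h, invFun := k, left_inv := hkh, right_inv := hhk
           continuous_toFun := continuous_of_apply_eq_zero_iff T h hiff
           continuous_invFun := continuous_of_apply_eq_zero_iff T.symm k hiff' }, hiff⟩

/-- The value at `y` of the image under `T` of constant functions. -/
noncomputable def constEval {X Y E F : Type*} [TopologicalSpace X] [TopologicalSpace Y]
    [CStarAlgebra E] [CStarAlgebra F] (T : C(X, E) ≃⋆ₐ[ℂ] C(Y, F)) (y : Y) : E →⋆ₐ[ℂ] F where
  toFun e := T (ContinuousMap.const X e) y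
  map_one' := by
    change T 1 y = 1
    simp
  map_mul' a b := by
    change T (ContinuousMap.const X a * ContinuousMap.const X b) y = _
    simp
  map_zero' := by
    change T 0 y = 0
    simp
  map_add' a b := by
    change T (ContinuousMap.const X a + ContinuousMap.const X b) y = _
    simp
  commutes' r := by
    have h : ContinuousMap.const X (algebraMap ℂ E r) = r • (1 : C(X, E)) := by
      ext x
      simp [Algebra.algebraMap_eq_smul_one]
    rw [h, map_smul, map_one]
    simp [Algebra.algebraMap_eq_smul_one]
  map_star' a := by
    change T (star (ContinuousMap.const X a)) y = _
    simp [map_star]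

theorem cstar_version {X Y E F : Type*}
    [TopologicalSpace X] [T2Space X] [CompletelyRegularSpace X]
    [TopologicalSpace Y] [T2Space Y] [CompletelyRegularSpace Y]
    (hX : Realcompact X) (hY : Realcompact Y)
    [CStarAlgebra E] [Nontrivial E] [CStarAlgebra F] [Nontrivial F]
    (T : C(X, E) ≃⋆ₐ[ℂ] C(Y, F))
    (hTz : ∀ f : C(X, E), {x | f x = 0}.Nonempty ↔ {y | T f y = 0}.Nonempty) :
    ∃ (h : Y ≃ₜ X) (S : Y → (E ≃⋆ₐ[ℂ] F)),
      ∀ (f : C(X, E)) (y : Y), T f y = S y (f (h y)) := by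
  obtain ⟨h, hh⟩ := exists_homeomorph_apply_eq_zero_iff hX hY T hTz
  have hS (f : C(X, E)) (y : Y) : T f y = constEval T y (f (h y)) := by
    have := (hh (f - ContinuousMap.const X (f (h y))) y).2 (by simp)
    rwa [map_sub, ContinuousMap.sub_apply, sub_eq_zero] at this
  have hbij (y : Y) : Function.Bijective (constEval T y) := by
    refine ⟨(injective_iff_map_eq_zero _).2 fun e he => (hh (.const X e) y).1 he, fun b => ?_⟩
    exact ⟨T.symm (.const Y b) (h y), by rw [← hS]; simp⟩
  exact ⟨h, fun y => StarAlgEquiv.ofBijective (constEval T y) (hbij y), hS⟩
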